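/- arXiv:2406.16618 — 2 statements merged into one kernel-verified Lean document; each statement's English description precedes it below -/
import Mathlib

section
/- Let k ≥ 5 be odd and let J_k be the flower (Isaacs) snark. Let u and v be vertices of J_k at distance at least 3 and let M be the graph obtained from J_k by deleting u and v and replacing each of the six deleted edges by a pendant edge at its endvertex different from u and v (retaining labels). Then for every edge g of J_k incident with u, every enumeration o1, o2, o3 of the three edges incident with v, and all colours a, b, c, d, e ∈ K with a + b = c + d + e ≠ (0,0), there exists a proper 3-edge-colouring φ of M with colours in K such that φ(g) = a, the colours of the other two pendant edges arising from edges at u sum to b, and (φ(o1), φ(o2), φ(o3)) = (c, d, e). -/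
/-- The colour set `K = (ℤ₂ × ℤ₂) ∖ {(0,0)}`. -/
abbrev Kol : Type := {x : ZMod 2 × ZMod 2 // x ≠ 0}

/-- A proper edge colouring: distinct edges sharing a vertex get distinct colours. -/
def IsProperEdgeColoring {V C : Type*} (G : SimpleGraph V) (f : Sym2 V → C) : Prop :=
  ∀ e₁ ∈ G.edgeSet, ∀ e₂ ∈ G.edgeSet, e₁ ≠ e₂ → (∃ v : V, v ∈ e₁ ∧ v ∈ e₂) → f e₁ ≠ f e₂

/-- A graph is 3-edge-colourable if it has a proper edge colouring with three colours. -/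
def ThreeEdgeColorable {V : Type*} (G : SimpleGraph V) : Prop :=
  ∃ f : Sym2 V → Kol, IsProperEdgeColoring G f

/-- A graph is cubic if every vertex has degree 3. -/
def IsCubic {V : Type*} (G : SimpleGraph V) : Prop :=
  ∀ v : V, (G.neighborSet v).ncard = 3

/-- A snark: a connected cubic simple graph which is not 3-edge-colourable. -/
def IsSnark {V : Type*} (G : SimpleGraph V) : Prop :=
  G.Connected ∧ IsCubic G ∧ ¬ ThreeEdgeColorable G

/-- A snark is critical if removing any two distinct adjacent vertices yields a
3-edge-colourable graph. -/
def Critical {V : Type*} (G : SimpleGraph V) : Prop :=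
  ∀ u v : V, G.Adj u v → ThreeEdgeColorable (G.induce ({u, v}ᶜ : Set V))

/-- A snark is bicritical if removing any two distinct vertices yields a
3-edge-colourable graph. -/
def Bicritical {V : Type*} (G : SimpleGraph V) : Prop :=
  ∀ u v : V, u ≠ v → ThreeEdgeColorable (G.induce ({u, v}ᶜ : Set V))

/-- Strictly critical: critical but not bicritical. -/
def StrictlyCritical {V : Type*} (G : SimpleGraph V) : Prop :=
  Critical G ∧ ¬ Bicritical G

/-- A cubic graph is cyclically `k`-connected if no set of fewer than `k` edges
separates two cycles, i.e. there is no set `F` of fewer than `k` edges whose deletion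
leaves a graph in which two connected components contain a cycle. -/
def CyclicallyConnected {V : Type*} (G : SimpleGraph V) (k : ℕ) : Prop :=
  ¬ ∃ F : Set (Sym2 V), F ⊆ G.edgeSet ∧ F.ncard < k ∧
    ∃ a b : V, (∃ w : (G.deleteEdges F).Walk a a, w.IsCycle) ∧
               (∃ w : (G.deleteEdges F).Walk b b, w.IsCycle) ∧
               ¬ (G.deleteEdges F).Reachable a b

/-- The cyclic connectivity of a cubic graph: the largest `k` (at most the number of
edges) such that the graph is cyclically `k`-connected. -/
noncomputable def cyclicConnectivity {V : Type*} (G : SimpleGraph V) : ℕ :=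
  sSup {k | k ≤ G.edgeSet.ncard ∧ CyclicallyConnected G k}

/-- The flower (Isaacs) snark `J_k`: vertices `a_i = (0, i)`, `b_i = (1, i)`,
`c_i = (2, i)`, `d_i = (3, i)` for `i ∈ ℤ/k`, with edges `a_i b_i`, `a_i c_i`,
`a_i d_i`, `b_i b_{i+1}`, `c_i d_{i+1}`, `d_i c_{i+1}`. -/
def flowerSnark (k : ℕ) : SimpleGraph (Fin 4 × ZMod k) :=
  SimpleGraph.fromRel (fun p q =>
    ∃ i : ZMod k,
      (p = (0, i) ∧ (q = (1, i) ∨ q = (2, i) ∨ q = (3, i))) ∨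
      (p = (1, i) ∧ q = (1, i + 1)) ∨
      (p = (2, i) ∧ q = (3, i + 1)) ∨
      (p = (3, i) ∧ q = (2, i + 1)))

/-- The `(3,3)`-pole `G − (u, v)` obtained from `G` by deleting the vertices `u` and
`v` (at distance at least 3, with neighbours `m 0, m 1, m 2` and `o 0, o 1, o 2`
respectively) and replacing each of the six deleted edges by a pendant edge at its
other endvertex; the six new degree-1 vertices are `Sum.inr 0, …, Sum.inr 5`. -/
def removeTwoVerticesPole {U : Type*} (G : SimpleGraph U) (u v : U) (m o : Fin 3 → U) :
    SimpleGraph (U ⊕ Fin 6) :=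
  SimpleGraph.fromRel (fun p q =>
    (∃ a b : U, p = Sum.inl a ∧ q = Sum.inl b ∧ G.Adj a b ∧
        a ≠ u ∧ a ≠ v ∧ b ≠ u ∧ b ≠ v) ∨
    (p = Sum.inl (m 0) ∧ q = Sum.inr 0) ∨ (p = Sum.inl (m 1) ∧ q = Sum.inr 1) ∨
    (p = Sum.inl (m 2) ∧ q = Sum.inr 2) ∨
    (p = Sum.inl (o 0) ∧ q = Sum.inr 3) ∨ (p = Sum.inl (o 1) ∧ q = Sum.inr 4) ∨
    (p = Sum.inl (o 2) ∧ q = Sum.inr 5))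

namespace FlowerSnark

/-! ### Blocks

The snark is cut into `k` blocks `{a_i, b_i, c_i, d_i}`. A block meets the previous one and the next
one in three rails each; a rail is indexed by the vertex `b`, `c` or `d` (`0`, `1` or `2`) that it
enters when the indices increase. Negation on `Fin 3` exchanges `c` and `d`. Colours are elements of
`Fin 3`. -/

/-- Colours indexed by `b`, `c`, `d`. -/
abbrev Row := Fin 3 → Fin 3

/-- Three pairwise distinct colours. -/
abbrev Rainbow (f : Row) : Prop := f 0 ≠ f 1 ∧ f 0 ≠ f 2 ∧ f 1 ≠ f 2

/-- The colours around a vertex of a block with entering rails `L`, leaving rails `R` and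
spokes `s`. -/
def vertexColours (L R s : Row) : Fin 4 → Row :=
  Fin.cases s fun l => ![s l, L l, R (-l)]

theorem Rainbow.injective {f : Row} (hf : Rainbow f) : Function.Injective f := by
  obtain ⟨h₁, h₂, h₃⟩ := hf
  intro i j h
  fin_cases i <;> fin_cases j <;>
    first
      | rfl
      | exact absurd h ‹_›
      | exact absurd h.symm ‹_›

/-- Colourings `(L, R, s)` of a block that are proper outside the vertex `x`, and have colours `D`
around `x`. -/
def blocks (x : Fin 4) (D : Row) : List (Row × Row × Row) :=
  let spokes : List Row :=
    Fin.cases [D] (fun l => [fun i => D 0 + (i - l), fun i => D 0 - (i - l)]) x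
  let rails (s : Row) (l : Fin 3) : List (Fin 3 × Fin 3) :=
    if x = l.succ then [(D 1, D 2)] else [(s l + 1, s l + 2), (s l + 2, s l + 1)]
  spokes.flatMap fun s =>
    (rails s 0).flatMap fun p => (rails s 1).flatMap fun q => (rails s 2).map fun r =>
      (![p.1, q.1, r.1], ![p.2, r.2, q.2], s)

theorem mem_blocks {x : Fin 4} {D : Row} {e : Row × Row × Row} (he : e ∈ blocks x D) :
    (∀ z, z ≠ x → Rainbow (vertexColours e.1 e.2.1 e.2.2 z)) ∧
      vertexColours e.1 e.2.1 e.2.2 x = D := by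
  have rails_spec (c : Fin 3) (p : Fin 3 × Fin 3)
      (hp : p ∈ [(c + 1, c + 2), (c + 2, c + 1)]) : Rainbow ![c, p.1, p.2] := by
    revert c p; decide
  have spokes_spec (c l : Fin 3) (s : Row)
      (hs : s ∈ [fun i => c + (i - l), fun i => c - (i - l)]) : Rainbow s ∧ s l = c := by
    simp only [List.mem_cons, List.not_mem_nil, or_false] at hs
    rcases hs with rfl | rfl <;> revert c l <;> decide
  simp only [blocks, List.mem_flatMap, List.mem_map] at he
  obtain ⟨s, hs, p, hp, q, hq, r, hr, rfl⟩ := he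
  have hrow (l : Fin 3) : ∃ t, ![s l, ![p.1, q.1, r.1] l, ![p.2, r.2, q.2] (-l)] =
      ![s l, t.1, t.2] ∧ t ∈ if x = l.succ then [(D 1, D 2)] else
        [(s l + 1, s l + 2), (s l + 2, s l + 1)] := by
    fin_cases l
    exacts [⟨p, rfl, hp⟩, ⟨q, rfl, hq⟩, ⟨r, rfl, hr⟩]
  constructor
  · refine Fin.cases (fun hx => ?_) (fun l hx => ?_)
    · obtain ⟨l, rfl⟩ := Fin.exists_succ_eq.2 hx.symm
      exact (spokes_spec _ _ _ hs).1
    · obtain ⟨t, ht, hmem⟩ := hrow l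
      rw [if_neg hx.symm] at hmem
      simp only [vertexColours, Fin.cases_succ]
      rw [ht]
      exact rails_spec _ _ hmem
  · induction x using Fin.cases with
    | zero => exact List.mem_singleton.1 hs
    | succ l =>
      obtain ⟨t, ht, hmem⟩ := hrow l
      simp only [if_true, List.mem_singleton] at hmem
      simp only [vertexColours, Fin.cases_succ]
      rw [ht, hmem, (spokes_spec _ _ _ hs).2]
      ext i
      fin_cases i <;> rfl

/-! ### Transfer through intact blocks -/

/-- The rails `A` and `B` extend to a proper colouring of an intact block between them. -/
abbrev Step (A B : Row) : Prop := ∃ s, ∀ z, Rainbow (vertexColours A B s z)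

/-- `A` and `B` are joined by `n` intact blocks. -/
def Steps : ℕ → Row → Row → Prop
  | 0, A, B => A = B
  | n + 1, A, B => ∃ M, Step A M ∧ Steps n M B

theorem Step.symm {A B : Row} (h : Step A B) : Step B A := by
  obtain ⟨s, hs⟩ := h
  refine ⟨fun l => s (-l), fun z => ?_⟩
  induction z using Fin.cases with
  | zero =>
    obtain ⟨h₁, h₂, h₃⟩ := hs 0
    exact ⟨h₂, h₁, h₃.symm⟩
  | succ l =>
    have h := hs (-l).succ
    simp only [vertexColours, Fin.cases_succ, neg_neg] at h ⊢
    exact ⟨h.2.1, h.1, h.2.2.symm⟩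

theorem Steps.add_two {n : ℕ} {A B : Row} (h : Steps (n + 1) A B) : Steps (n + 3) A B := by
  obtain ⟨M, hAM, hMB⟩ := h
  exact ⟨M, hAM, A, hAM.symm, M, hAM, hMB⟩

/-- An invariant of the rails along intact blocks: for an even number of blocks `key 0` is
preserved, for an odd number `key 2` at one end is `key 0` at the other. -/
def key (e : Fin 3) (A : Row) : ℕ :=
  if A 1 = A 2 then 3 * (A 0).val + (A 1 + e * (A 0 - A 1)).val
  else if A 0 = A 2 then 3 * (A 1).val + (A 0 + e * (A 1 - A 0)).val
  else if A 0 = A 1 then 3 * (A 2).val + (A 0 + e * (A 2 - A 0)).val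
  else 9 + ((A 1 - A 0) * (1 - e)).val

/-- Fast test for inequality of colours. -/
def differ (a b : Fin 3) : Bool := !(Nat.beq a.val b.val)

/-- A test for `Steps n A B`. -/
def linked : ℕ → Row → Row → Bool
  | 0, A, B => !(differ (A 0) (B 0)) && !(differ (A 1) (B 1)) && !(differ (A 2) (B 2))
  | 1, A, B => differ (A 0) (B 0) && differ (A 1) (B 2) && differ (A 2) (B 1) &&
      differ (A 0 + B 0) (A 1 + B 2) && differ (A 0 + B 0) (A 2 + B 1) &&
      differ (A 1 + B 2) (A 2 + B 1)
  | n + 2, A, B => Nat.beq (key (Fin.ofNat 3 (2 * (n % 2))) A) (key 0 B) &&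
      (differ (A 0) (A 1) || differ (A 1) (A 2))

theorem linked_add_two (n : ℕ) : linked (n + 2) = linked (n % 2 + 2) := by
  ext A B
  simp [linked]

theorem step_of_linked {A B : Row} (h : linked 1 A B = true) : Step A B := by
  refine ⟨fun l => -(A l + B (-l)), ?_⟩
  revert A B
  decide +kernel

theorem exists_linked_one_one :
    ∀ A B, linked 2 A B = true → ∃ M, linked 1 A M = true ∧ linked 1 M B = true := by
  decide +kernel

theorem exists_linked_one_two :
    ∀ A B, linked 3 A B = true → ∃ M, linked 1 A M = true ∧ linked 2 M B = true := by
  decide +kernel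

theorem steps_of_linked : ∀ {n : ℕ} {A B : Row}, linked n A B = true → Steps n A B
  | 0, A, B, h => by
    have h' : A 0 = B 0 ∧ A 1 = B 1 ∧ A 2 = B 2 := by
      simpa [linked, differ, Fin.ext_iff, and_assoc] using h
    obtain ⟨h₀, h₁, h₂⟩ := h'
    funext i
    fin_cases i <;> assumption
  | 1, A, B, h => ⟨B, step_of_linked h, rfl⟩
  | 2, A, B, h => by
    obtain ⟨M, h₁, h₂⟩ := exists_linked_one_one A B h
    exact ⟨M, step_of_linked h₁, B, step_of_linked h₂, rfl⟩
  | 3, A, B, h => by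
    obtain ⟨M, h₁, h₂⟩ := exists_linked_one_two A B h
    exact ⟨M, step_of_linked h₁, steps_of_linked h₂⟩
  | n + 4, A, B, h => by
    rw [linked_add_two, Nat.add_mod_right, ← linked_add_two] at h
    exact (steps_of_linked h).add_two

/-! ### The finite search -/

/-- One colour is `2` and the other two are equal, so that the sum in `K` is the colour `2`. -/
abbrev Good (C : Row) : Prop := ∃ i, C i = 2 ∧ C (i + 1) = C (i + 2)

theorem Good.comp_equiv : ∀ {C : Row}, Good C → ∀ τ : Equiv.Perm (Fin 3), Good (C ∘ τ) := by
  decide +kernel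

/-- The rows with colour `0` at `g` and colours `0`, `2` elsewhere. -/
def sourceRows (g : Fin 3) : List Row :=
  [fun j => if j = g then 0 else 1 - (j - g), fun j => if j = g then 0 else (j - g) - 2]

theorem mem_sourceRows : ∀ {g : Fin 3}, ∀ D ∈ sourceRows g, ∀ i j, g ≠ i → g ≠ j → i ≠ j →
    D g = 0 ∧ (D i = 0 ∧ D j = 2 ∨ D i = 2 ∧ D j = 0) := by
  decide

/-- Search for a colouring, where `x` and `y` are deleted from blocks which are `p` blocks
apart on one side and `q` blocks apart on the other side. -/
def search (p q : ℕ) (x y : Fin 4) (g : Fin 3) (C : Row) : Bool :=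
  (sourceRows g).any fun D => (blocks x D).any fun U => (blocks y C).any fun V =>
    linked p U.2.1 V.1 && linked q V.2.1 U.1

/-- The vertex `y` is at distance at least `3` from `x` when its block comes after that of `x` with
`n` blocks in between. -/
def Admissible (n : ℕ) (x y : Fin 4) : Prop :=
  (n = 0 → (x = 0 ↔ y = 0) ∧ ∀ l : Fin 3, x = l.succ → y ≠ (-l).succ) ∧
    (n = 1 → ∀ l : Fin 3, x = l.succ → y ≠ l.succ)

instance (n : ℕ) (x y : Fin 4) : Decidable (Admissible n x y) :=
  inferInstanceAs (Decidable (_ ∧ _))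

theorem search_of_le_three : ∀ t ∈ [(0, 3), (3, 0), (1, 2), (2, 1), (2, 3), (3, 2)], ∀ x y,
    Admissible t.1 x y → Admissible t.2 y x → ∀ g C, Good C → search t.1 t.2 x y g C = true := by
  decide +kernel

theorem search_eq_true {p q : ℕ} (hodd : Odd (p + q)) (hpq : 3 ≤ p + q) {x y : Fin 4}
    (hp : Admissible p x y) (hq : Admissible q y x) (g : Fin 3) {C : Row} (hC : Good C) :
    search p q x y g C = true := by
  have reduce (n : ℕ) : ∃ n' ≤ 3, linked n = linked n' ∧ n' % 2 = n % 2 ∧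
      (n' = 0 ↔ n = 0) ∧ (n' = 1 ↔ n = 1) := by
    match n with
    | 0 => exact ⟨0, by simp⟩
    | 1 => exact ⟨1, by simp⟩
    | n + 2 => exact ⟨n % 2 + 2, by lia, linked_add_two n, by lia, by lia, by lia⟩
  obtain ⟨p', hp', hlp, hp2, hp0, hp1⟩ := reduce p
  obtain ⟨q', hq', hlq, hq2, hq0, hq1⟩ := reduce q
  have hmem : (p', q') ∈ [(0, 3), (3, 0), (1, 2), (2, 1), (2, 3), (3, 2)] := by
    rw [Nat.odd_iff] at hodd
    simp only [List.mem_cons, Prod.mk.injEq, List.not_mem_nil, or_false]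
    lia
  have h := search_of_le_three _ hmem x y (by rwa [Admissible, hp0, hp1])
    (by rwa [Admissible, hq0, hq1]) g C hC
  rwa [search, ← hlp, ← hlq] at h

/-! ### Gluing blocks -/

/-- Rails at the positions from `m` to `n`, such that consecutive ones are related by `Q`. -/
def Chain (Q : ℕ → Row → Row → Prop) (m n : ℕ) (A B : Row) : Prop :=
  ∃ f : ℕ → Row, f m = A ∧ f n = B ∧ ∀ i, m ≤ i → i < n → Q i (f i) (f (i + 1))

namespace Chain

variable {Q : ℕ → Row → Row → Prop} {l m n : ℕ} {A B M : Row}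

theorem single (h : Q m A B) : Chain Q m (m + 1) A B := by
  refine ⟨fun i => if i = m then A else B, by simp, by simp, fun i h₁ h₂ => ?_⟩
  obtain rfl : i = m := by lia
  simpa using h

theorem trans (hml : m ≤ l) (hln : l ≤ n) (h₁ : Chain Q m l A M) (h₂ : Chain Q l n M B) :
    Chain Q m n A B := by
  obtain ⟨f, hfm, hfl, hf⟩ := h₁
  obtain ⟨f', hfl', hfn', hf'⟩ := h₂
  have hglue {i : ℕ} (hi : l ≤ i) : (if i ≤ l then f i else f' i) = f' i := by
    split_ifs with h
    · rw [le_antisymm h hi, hfl, hfl']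
    · rfl
  refine ⟨fun i => if i ≤ l then f i else f' i, by simp [hml, hfm], ?_, fun i h₁ h₂ => ?_⟩
  · exact (hglue hln).trans hfn'
  · rcases lt_or_ge i l with hi | hi
    · simpa [hi.le, Nat.succ_le_of_lt hi] using hf i h₁ hi
    · simpa only [hglue hi, hglue (Nat.le_succ_of_le hi)] using hf' i hi h₂

theorem of_steps (h : Steps n A B)
    (hQ : ∀ i, m ≤ i → i < m + n → ∀ A B, Step A B → Q i A B) : Chain Q m (m + n) A B := by
  induction n generalizing m A with
  | zero => exact ⟨fun _ => A, rfl, h, fun i h₁ h₂ => by lia⟩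
  | succ n ih =>
    obtain ⟨M, hAM, hMB⟩ := h
    have h := ih (m := m + 1) hMB fun i h₁ h₂ => hQ i (by lia) (by lia)
    rw [show m + (n + 1) = m + 1 + n by lia]
    exact (single (hQ m le_rfl (by lia) A M hAM)).trans (by lia) (by lia) h

end Chain

/-- A cyclic sequence of blocks that is coloured properly outside `x` in block `0` and `y` in
block `p + 1`. -/
theorem exists_cyclic_colouring {p q : ℕ} (hodd : Odd (p + q)) (hpq : 3 ≤ p + q) {x y : Fin 4}
    (hp : Admissible p x y) (hq : Admissible q y x) (g : Fin 3) {C : Row} (hC : Good C) :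
    ∃ f s : ℕ → Row, f (p + q + 2) = f 0 ∧
      (∀ i < p + q + 2, ∀ z, (z, i) ≠ (x, 0) → (z, i) ≠ (y, p + 1) →
        Rainbow (vertexColours (f i) (f (i + 1)) (s i) z)) ∧
      vertexColours (f 0) (f 1) (s 0) x ∈ sourceRows g ∧
      vertexColours (f (p + 1)) (f (p + 2)) (s (p + 1)) y = C := by
  have h := search_eq_true hodd hpq hp hq g hC
  simp only [search, List.any_eq_true, Bool.and_eq_true] at h
  obtain ⟨D, hD, ⟨L, R, s⟩, hU, ⟨L', R', s'⟩, hV, hlp, hlq⟩ := h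
  obtain ⟨hU, hUx⟩ := mem_blocks hU
  obtain ⟨hV, hVy⟩ := mem_blocks hV
  dsimp only at hlp hlq hU hUx hV hVy
  let Q (i : ℕ) (A B : Row) : Prop := ∃ s,
    (∀ z, (z, i) ≠ (x, 0) → (z, i) ≠ (y, p + 1) → Rainbow (vertexColours A B s z)) ∧
      (i = 0 → vertexColours A B s x = D) ∧ (i = p + 1 → vertexColours A B s y = C)
  have hstep {i : ℕ} (h₀ : i ≠ 0) (h₁ : i ≠ p + 1) (A B : Row) : Step A B → Q i A B :=
    fun ⟨s, hs⟩ => ⟨s, fun z _ _ => hs z, fun h => absurd h h₀, fun h => absurd h h₁⟩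
  have hx : Q 0 L R := ⟨s, fun z hz _ => hU z (by simpa using hz), fun _ => hUx, by lia⟩
  have hy : Q (p + 1) L' R' := ⟨s', fun z _ hz => hV z (by simpa using hz), by lia, fun _ => hVy⟩
  have hchain : Chain Q 0 (p + q + 2) L L := by
    have h₁ : Chain Q 1 (1 + p) R L' :=
      .of_steps (steps_of_linked hlp) fun i _ _ => hstep (by lia) (by lia)
    have h₂ : Chain Q (p + 2) (p + 2 + q) R' L :=
      .of_steps (steps_of_linked hlq) fun i _ _ => hstep (by lia) (by lia)
    rw [add_comm 1 p] at h₁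
    rw [show p + q + 2 = p + 2 + q by lia]
    exact (((Chain.single hx).trans (by lia) (by lia) h₁).trans (by lia) (by lia)
      (Chain.single hy)).trans (by lia) (by lia) h₂
  obtain ⟨f, hf0, hfn, hf⟩ := hchain
  have hQ (i : ℕ) : ∃ s, i < p + q + 2 →
      (∀ z, (z, i) ≠ (x, 0) → (z, i) ≠ (y, p + 1) →
        Rainbow (vertexColours (f i) (f (i + 1)) s z)) ∧
      (i = 0 → vertexColours (f i) (f (i + 1)) s x = D) ∧
      (i = p + 1 → vertexColours (f i) (f (i + 1)) s y = C) := by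
    by_cases hi : i < p + q + 2
    · obtain ⟨s, hs⟩ := hf i i.zero_le hi
      exact ⟨s, fun _ => hs⟩
    · exact ⟨0, fun h => absurd h hi⟩
  choose s hs using hQ
  refine ⟨f, s, hfn.trans hf0.symm, fun i hi => (hs i hi).1, ?_, (hs (p + 1) (by lia)).2.2 rfl⟩
  rw [(hs 0 (by lia)).2.1 rfl]
  exact hD

/-! ### Edge colourings of the flower snark -/

variable {k : ℕ}

/-- The three neighbours of a vertex of the flower snark, in the order of `vertexColours`. -/
def nbr (x : Fin 4 × ZMod k) : Fin 3 → Fin 4 × ZMod k :=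
  Fin.cases (motive := fun _ => Fin 3 → Fin 4 × ZMod k) (fun l => (l.succ, x.2))
    (fun l => ![(0, x.2), ((-l).succ, x.2 - 1), ((-l).succ, x.2 + 1)]) x.1

theorem nbr_zero (i : ZMod k) (l : Fin 3) : nbr (0, i) l = (l.succ, i) := rfl

theorem nbr_succ (i : ZMod k) (l : Fin 3) :
    nbr (l.succ, i) = ![(0, i), ((-l).succ, i - 1), ((-l).succ, i + 1)] := rfl

/-- The index of `x` among the neighbours of `nbr x j`. -/
def back (z : Fin 4) (j : Fin 3) : Fin 3 :=
  Fin.cases (motive := fun _ => Fin 3) 0 (fun l => ![l, 2, 1] j) z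

theorem nbr_back (x : Fin 4 × ZMod k) (j : Fin 3) : nbr (nbr x j) (back x.1 j) = x := by
  obtain ⟨z, i⟩ := x
  induction z using Fin.cases with
  | zero => rfl
  | succ l => fin_cases j <;> simp [nbr_succ, nbr_zero, back]

theorem nbr_injective (hk : 3 ≤ k) (x : Fin 4 × ZMod k) : Function.Injective (nbr x) := by
  have h2 : (2 : ZMod k) ≠ 0 := by
    intro h
    have := (ZMod.natCast_eq_zero_iff 2 k).1 (by exact_mod_cast h)
    exact absurd (Nat.le_of_dvd two_pos this) (by lia)
  obtain ⟨z, i⟩ := x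
  induction z using Fin.cases with
  | zero => exact fun l l' h => by simpa [nbr_zero] using h
  | succ l =>
    have hne : i - 1 ≠ i + 1 := fun h => h2 (by linear_combination -h)
    intro j j' h
    fin_cases j <;> fin_cases j' <;>
      simp_all [nbr_succ, eq_comm (a := (0 : Fin 4)), eq_comm (a := i + 1)]

theorem adj_iff (hk : 3 ≤ k) {x y : Fin 4 × ZMod k} :
    (flowerSnark k).Adj x y ↔ ∃ j, nbr x j = y := by
  have : Fact (1 < k) := ⟨by lia⟩
  constructor
  · have key {x y : Fin 4 × ZMod k} (h : ∃ i : ZMod k,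
        (x = (0, i) ∧ (y = (1, i) ∨ y = (2, i) ∨ y = (3, i))) ∨ (x = (1, i) ∧ y = (1, i + 1)) ∨
        (x = (2, i) ∧ y = (3, i + 1)) ∨ (x = (3, i) ∧ y = (2, i + 1))) : ∃ j, nbr x j = y := by
      obtain ⟨i, ⟨rfl, rfl | rfl | rfl⟩ | ⟨rfl, rfl⟩ | ⟨rfl, rfl⟩ | ⟨rfl, rfl⟩⟩ := h
      exacts [⟨0, rfl⟩, ⟨1, rfl⟩, ⟨2, rfl⟩, ⟨2, rfl⟩, ⟨2, rfl⟩, ⟨2, rfl⟩]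
    rintro ⟨-, h | h⟩
    · exact key h
    · obtain ⟨j, rfl⟩ := key h
      exact ⟨_, nbr_back _ _⟩
  · rintro ⟨j, rfl⟩
    have spoke (i : ZMod k) (l : Fin 3) : (flowerSnark k).Adj (0, i) (l.succ, i) := by
      fin_cases l <;> simp [flowerSnark]
    have rail (i : ZMod k) (l : Fin 3) :
        (flowerSnark k).Adj (l.succ, i) ((-l).succ, i + 1) := by
      fin_cases l
      exacts [⟨by simp, .inl ⟨i, .inr (.inl ⟨rfl, rfl⟩)⟩⟩,
        ⟨by simp, .inl ⟨i, .inr (.inr (.inl ⟨rfl, rfl⟩))⟩⟩,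
        ⟨by simp, .inl ⟨i, .inr (.inr (.inr ⟨rfl, rfl⟩))⟩⟩]
    obtain ⟨z, i⟩ := x
    induction z using Fin.cases with
    | zero => exact spoke i j
    | succ l =>
      fin_cases j
      · exact (spoke i l).symm
      · simpa [nbr_succ] using (rail (i - 1) (-l)).symm
      · exact rail i l

theorem exists_edge_colouring (hk : 3 ≤ k) (L s : ZMod k → Row) :
    ∃ ψ : Sym2 (Fin 4 × ZMod k) → Fin 3, ∀ x j,
      ψ s(x, nbr x j) = vertexColours (L x.2) (L (x.2 + 1)) (s x.2) x.1 j := by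
  have hback (x : Fin 4 × ZMod k) (j : Fin 3) :
      vertexColours (L (nbr x j).2) (L ((nbr x j).2 + 1)) (s (nbr x j).2) (nbr x j).1 (back x.1 j) =
        vertexColours (L x.2) (L (x.2 + 1)) (s x.2) x.1 j := by
    obtain ⟨z, i⟩ := x
    induction z using Fin.cases with
    | zero => rfl
    | succ l => fin_cases j <;> simp [nbr_succ, back, vertexColours]
  classical
  let ψ (e : Sym2 (Fin 4 × ZMod k)) : Fin 3 :=
    if h : ∃ t : (Fin 4 × ZMod k) × Fin 3, s(t.1, nbr t.1 t.2) = e then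
      vertexColours (L h.choose.1.2) (L (h.choose.1.2 + 1)) (s h.choose.1.2) h.choose.1.1 h.choose.2
    else 0
  refine ⟨ψ, fun x j => ?_⟩
  have h : ∃ t : (Fin 4 × ZMod k) × Fin 3, s(t.1, nbr t.1 t.2) = s(x, nbr x j) := ⟨(x, j), rfl⟩
  simp only [ψ, dif_pos h]
  have ht := h.choose_spec
  generalize h.choose = t at ht ⊢
  obtain ⟨y, l⟩ := t
  rcases Sym2.eq_iff.1 ht with ⟨rfl, h⟩ | ⟨rfl, h⟩
  · rw [nbr_injective hk _ h]
  · have hl : l = back x.1 j := nbr_injective hk _ (h.trans (nbr_back x j).symm)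
    exact hl ▸ hback x j

theorem admissible_of_far (hk : 3 ≤ k) {u v : Fin 4 × ZMod k} {n : ℕ}
    (hn : v.2 = u.2 + (n + 1 : ℕ)) (hadj : ¬ (flowerSnark k).Adj u v)
    (hcommon : ∀ w, (flowerSnark k).Adj u w → ¬ (flowerSnark k).Adj v w) :
    Admissible n u.1 v.1 := by
  rw [adj_iff hk, not_exists] at hadj
  have hcommon (j l : Fin 3) : nbr u j ≠ nbr v l := fun h =>
    hcommon _ ((adj_iff hk).2 ⟨j, rfl⟩) ((adj_iff hk).2 ⟨l, h.symm⟩)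
  obtain ⟨x, i⟩ := u
  obtain ⟨y, i'⟩ := v
  dsimp only at hn ⊢
  subst hn
  refine ⟨?_, ?_⟩
  · rintro rfl
    induction x using Fin.cases with
    | zero =>
      induction y using Fin.cases with
      | zero => simp [eq_comm (a := (0 : Fin 4))]
      | succ l => exact absurd (by simp [nbr_succ, nbr_zero]) (hcommon (-l) 1)
    | succ l =>
      induction y using Fin.cases with
      | zero => exact absurd (by simp [nbr_succ, nbr_zero]) (hcommon 2 (-l))
      | succ l' =>
        refine ⟨by simp, ?_⟩
        rintro j hj h
        rw [Fin.succ_inj] at hj h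
        subst hj h
        exact absurd (by simp [nbr_succ]) (hadj 2)
  · rintro rfl l rfl rfl
    refine absurd ?_ (hcommon 2 1)
    simp only [nbr_succ]
    simp
    ring

theorem snd_ne_of_far (hk : 3 ≤ k) {u v : Fin 4 × ZMod k} (huv : u ≠ v)
    (hadj : ¬ (flowerSnark k).Adj u v)
    (hcommon : ∀ w, (flowerSnark k).Adj u w → ¬ (flowerSnark k).Adj v w) : u.2 ≠ v.2 := by
  intro h
  have centre (x : Fin 4 × ZMod k) : x.1 = 0 ∨ (flowerSnark k).Adj x (0, x.2) := by
    obtain ⟨z, i⟩ := x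
    induction z using Fin.cases with
    | zero => exact .inl rfl
    | succ l => exact .inr ((adj_iff hk).2 ⟨0, rfl⟩)
  rcases centre u with hu | hu <;> rcases centre v with hv | hv
  · exact huv (Prod.ext (hu.trans hv.symm) h)
  · rw [← hu, ← h] at hv
    exact hadj hv.symm
  · rw [← hv, h] at hu
    exact hadj hu
  · rw [h] at hu
    exact hcommon _ hu hv

/-- Colours in `K` for the colours `0`, `1` and `2`, when the required sums are equal to `t`. -/
theorem exists_colours {a b c d e t : Kol} (hab : a.1 + b.1 = t.1)
    (hcde : c.1 + d.1 + e.1 = t.1) :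
    ∃ col : Fin 3 → Kol, Function.Injective col ∧ col 0 = a ∧ (col 0).1 + (col 2).1 = b.1 ∧
      ∃ C, Good C ∧ col ∘ C = ![c, d, e] := by
  have hinj : ∀ a b t : Kol, a.1 + b.1 = t.1 →
      (∀ i j, ![a, b, t] i = ![a, b, t] j → i = j) ∧ a.1 + t.1 = b.1 := by
    decide +kernel
  have hpair : ∀ c d e t : Kol, c.1 + d.1 + e.1 = t.1 →
      c = t ∧ d = e ∨ d = t ∧ c = e ∨ e = t ∧ c = d := by
    set_option synthInstance.maxSize 1000 in
    decide +kernel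
  obtain ⟨hinj, hb⟩ := hinj a b t hab
  refine ⟨![a, b, t], hinj, rfl, hb, ?_⟩
  have hsurj : Function.Surjective ![a, b, t] :=
    (Function.Injective.bijective_of_nat_card_le hinj (by simp)).2
  obtain ⟨rfl, rfl⟩ | ⟨rfl, rfl⟩ | ⟨rfl, rfl⟩ := hpair c d e t hcde
  · obtain ⟨i, hi⟩ := hsurj d
    exact ⟨![2, i, i], ⟨0, rfl, rfl⟩, by simp [← List.ofFn_inj, hi]⟩
  · obtain ⟨i, hi⟩ := hsurj c
    exact ⟨![i, 2, i], ⟨1, rfl, rfl⟩, by simp [← List.ofFn_inj, hi]⟩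
  · obtain ⟨i, hi⟩ := hsurj c
    exact ⟨![i, i, 2], ⟨2, rfl, rfl⟩, by simp [← List.ofFn_inj, hi]⟩

end FlowerSnark

/-- A colouring of the edges of `G` that is proper outside `u` and `v` is a colouring of the pole
obtained by removing `u` and `v`. -/
theorem exists_pole_coloring {U C : Type*} {G : SimpleGraph U} {u v : U} {m o : Fin 3 → U}
    (hm : ∀ j, G.Adj u (m j)) (ho : ∀ j, G.Adj v (o j)) (hminj : Function.Injective m)
    (hoinj : Function.Injective o) (huv : u ≠ v) (hadj : ¬ G.Adj u v) (ψ : Sym2 U → C)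
    (hψ : ∀ x, x ≠ u → x ≠ v → ∀ y z, G.Adj x y → G.Adj x z → y ≠ z → ψ s(x, y) ≠ ψ s(x, z)) :
    ∃ φ : Sym2 (U ⊕ Fin 6) → C, IsProperEdgeColoring (removeTwoVerticesPole G u v m o) φ ∧
      (∀ j : Fin 3, φ s(.inl (m j), .inr (j.castAdd 3)) = ψ s(u, m j)) ∧
      ∀ j : Fin 3, φ s(.inl (o j), .inr (j.natAdd 3)) = ψ s(v, o j) := by
  let h : U ⊕ Fin 6 → U := Sum.elim id (Fin.append (fun _ : Fin 3 => u) (fun _ : Fin 3 => v))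
  have hu (j : Fin 3) : h (.inr (j.castAdd 3)) = u := Fin.append_left _ _ j
  have hv (j : Fin 3) : h (.inr (j.natAdd 3)) = v := Fin.append_right _ _ j
  have inl_inl {a b : U} (hab : (removeTwoVerticesPole G u v m o).Adj (.inl a) (.inl b)) :
      G.Adj a b ∧ a ≠ u ∧ a ≠ v ∧ b ≠ u ∧ b ≠ v := by
    simp only [removeTwoVerticesPole, SimpleGraph.fromRel_adj] at hab
    grind [SimpleGraph.adj_symm]
  have inl_inr {a : U} {i : Fin 6}
      (hai : (removeTwoVerticesPole G u v m o).Adj (.inl a) (.inr i)) :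
      (∃ j : Fin 3, a = m j ∧ i = j.castAdd 3) ∨ ∃ j : Fin 3, a = o j ∧ i = j.natAdd 3 := by
    simp [removeTwoVerticesPole] at hai
    obtain ⟨rfl, rfl⟩ | ⟨rfl, rfl⟩ | ⟨rfl, rfl⟩ | ⟨rfl, rfl⟩ | ⟨rfl, rfl⟩ | ⟨rfl, rfl⟩ := hai
    exacts [.inl ⟨0, rfl, rfl⟩, .inl ⟨1, rfl, rfl⟩, .inl ⟨2, rfl, rfl⟩, .inr ⟨0, rfl, rfl⟩,
      .inr ⟨1, rfl, rfl⟩, .inr ⟨2, rfl, rfl⟩]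
  have inr_inr {i j : Fin 6} : ¬ (removeTwoVerticesPole G u v m o).Adj (.inr i) (.inr j) := by
    simp [removeTwoVerticesPole]
  have hinl {x : U} {y : U ⊕ Fin 6} (hxy : (removeTwoVerticesPole G u v m o).Adj (.inl x) y) :
      x ≠ u ∧ x ≠ v ∧ G.Adj x (h y) := by
    obtain b | i := y
    · obtain ⟨hab, hau, hav, -⟩ := inl_inl hxy
      exact ⟨hau, hav, hab⟩
    · obtain ⟨j, rfl, rfl⟩ | ⟨j, rfl, rfl⟩ := inl_inr hxy
      · rw [hu]
        exact ⟨(hm j).ne', fun h => hadj (h ▸ hm j), (hm j).symm⟩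
      · rw [hv]
        exact ⟨fun h => hadj (h ▸ ho j).symm, (ho j).ne', (ho j).symm⟩
  have hinj {x : U} {y z : U ⊕ Fin 6} (hxy : (removeTwoVerticesPole G u v m o).Adj (.inl x) y)
      (hxz : (removeTwoVerticesPole G u v m o).Adj (.inl x) z) (hyz : h y = h z) : y = z := by
    obtain b | i := y <;> obtain b' | i' := z
    · exact congrArg _ hyz
    · obtain ⟨-, -, -, hbu, hbv⟩ := inl_inl hxy
      obtain ⟨j, -, rfl⟩ | ⟨j, -, rfl⟩ := inl_inr hxz
      exacts [absurd (hyz.trans (hu j)) hbu, absurd (hyz.trans (hv j)) hbv]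
    · obtain ⟨-, -, -, hbu, hbv⟩ := inl_inl hxz
      obtain ⟨j, -, rfl⟩ | ⟨j, -, rfl⟩ := inl_inr hxy
      exacts [absurd (hyz.symm.trans (hu j)) hbu, absurd (hyz.symm.trans (hv j)) hbv]
    · obtain ⟨j, hj, rfl⟩ | ⟨j, hj, rfl⟩ := inl_inr hxy <;>
        obtain ⟨j', hj', rfl⟩ | ⟨j', hj', rfl⟩ := inl_inr hxz
      · rw [hminj (hj.symm.trans hj')]
      · exact absurd ((hu j).symm.trans (hyz.trans (hv j'))) huv
      · exact absurd ((hu j').symm.trans (hyz.symm.trans (hv j))) huv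
      · rw [hoinj (hj.symm.trans hj')]
  refine ⟨fun e => ψ (e.map h), ?_, fun j => ?_, fun j => ?_⟩
  · rintro e₁ he₁ e₂ he₂ hne ⟨w, ⟨y, rfl⟩, ⟨z, rfl⟩⟩
    rw [SimpleGraph.mem_edgeSet] at he₁ he₂
    have hyz : y ≠ z := fun h => hne (h ▸ rfl)
    obtain x | i := w
    · obtain ⟨hxu, hxv, hxy⟩ := hinl he₁
      exact hψ x hxu hxv _ _ hxy (hinl he₂).2.2 fun h => hyz (hinj he₁ he₂ h)
    · obtain b | i' := y
      swap
      · exact absurd he₁ inr_inr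
      obtain b' | i'' := z
      swap
      · exact absurd he₂ inr_inr
      refine absurd (congrArg Sum.inl ?_) hyz
      obtain ⟨j, rfl, hj⟩ | ⟨j, rfl, hj⟩ := inl_inr he₁.symm <;>
        obtain ⟨j', rfl, hj'⟩ | ⟨j', rfl, hj'⟩ := inl_inr he₂.symm <;>
        simp only [Fin.ext_iff, Fin.val_castAdd, Fin.val_natAdd] at hj hj'
      · rw [Fin.ext (hj.symm.trans hj')]
      · lia
      · lia
      · rw [Fin.ext (by lia : j.val = j'.val)]
  · change ψ s(m j, h (.inr (j.castAdd 3))) = _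
    rw [hu, Sym2.eq_swap]
  · change ψ s(o j, h (.inr (j.natAdd 3))) = _
    rw [hv, Sym2.eq_swap]

/-- Let `k ≥ 5` be odd and let `u, v` be vertices of the flower snark
`J_k` at distance at least 3.  In the `(3,3)`-pole `M = J_k − (u, v)`, for every edge
`g` of `J_k` incident with `u` (here the pendant edge at `m 0`), every enumeration
`o 0, o 1, o 2` of the edges at `v`, and all colours `a, b, c, d, e ∈ K` with
`a + b = c + d + e ≠ 0`, some proper 3-edge-colouring `φ` of `M` has `φ(g) = a`, the
colours of the other two pendant edges at `u` summing to `b`, and colours `c, d, e`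
on the pendant edges at `v`. -/
theorem flowerSnark_removeTwo_coloring
    (k : ℕ) (hk : 5 ≤ k) (hodd : Odd k)
    (u v : Fin 4 × ZMod k) (hdist : 3 ≤ (flowerSnark k).dist u v)
    (m o : Fin 3 → Fin 4 × ZMod k)
    (hm : (flowerSnark k).neighborSet u = {m 0, m 1, m 2})
    (hminj : Function.Injective m)
    (ho : (flowerSnark k).neighborSet v = {o 0, o 1, o 2})
    (hoinj : Function.Injective o)
    (a b c d e : Kol)
    (hsum : (a : ZMod 2 × ZMod 2) + (b : ZMod 2 × ZMod 2)
        = (c : ZMod 2 × ZMod 2) + (d : ZMod 2 × ZMod 2) + (e : ZMod 2 × ZMod 2))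
    (hne : (c : ZMod 2 × ZMod 2) + (d : ZMod 2 × ZMod 2) + (e : ZMod 2 × ZMod 2) ≠ 0) :
    ∃ φ : Sym2 ((Fin 4 × ZMod k) ⊕ Fin 6) → Kol,
      IsProperEdgeColoring (removeTwoVerticesPole (flowerSnark k) u v m o) φ ∧
      φ s(Sum.inl (m 0), Sum.inr 0) = a ∧
      (φ s(Sum.inl (m 1), Sum.inr 1) : ZMod 2 × ZMod 2)
        + (φ s(Sum.inl (m 2), Sum.inr 2) : ZMod 2 × ZMod 2) = (b : ZMod 2 × ZMod 2) ∧
      φ s(Sum.inl (o 0), Sum.inr 3) = c ∧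
      φ s(Sum.inl (o 1), Sum.inr 4) = d ∧
      φ s(Sum.inl (o 2), Sum.inr 5) = e := by
  have hk3 : 3 ≤ k := by lia
  have : NeZero k := ⟨by lia⟩
  have : Fact (1 < k) := ⟨by lia⟩
  have huv : u ≠ v := by
    rintro rfl
    simp at hdist
  have hadj : ¬ (flowerSnark k).Adj u v := fun h => by
    have := SimpleGraph.dist_le h.toWalk
    simp at this
    lia
  have hcommon (w) (hu : (flowerSnark k).Adj u w) : ¬ (flowerSnark k).Adj v w := fun hv => by
    have := SimpleGraph.dist_le (hu.toWalk.append hv.symm.toWalk)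
    simp at this
    lia
  -- The numbers of blocks between those of `u` and `v`.
  obtain ⟨p, q, hpq, hp, hq⟩ : ∃ p q : ℕ, k = p + q + 2 ∧ v.2 = u.2 + (p + 1 : ℕ) ∧
      u.2 = v.2 + (q + 1 : ℕ) := by
    have hval : v.2 = u.2 + ((v.2 - u.2).val : ℕ) := by simp
    have hpos : (v.2 - u.2).val ≠ 0 := by
      rw [Ne, ZMod.val_eq_zero, sub_eq_zero]
      exact (FlowerSnark.snd_ne_of_far hk3 huv hadj hcommon).symm
    have hlt := ZMod.val_lt (v.2 - u.2)
    generalize (v.2 - u.2).val = n at hval hpos hlt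
    refine ⟨n - 1, k - n - 1, by lia, by rwa [Nat.sub_add_cancel (by lia)], ?_⟩
    rw [hval, add_assoc, ← Nat.cast_add, show n + (k - n - 1 + 1) = k by lia]
    simp
  have hpos : (v.2 - u.2).val = p + 1 := by
    rw [hp, add_sub_cancel_left, ZMod.val_cast_of_lt (by lia)]
  have hmu (j : Fin 3) : (flowerSnark k).Adj u (m j) := by
    rw [← SimpleGraph.mem_neighborSet, hm]
    fin_cases j <;> simp
  have hov (j : Fin 3) : (flowerSnark k).Adj v (o j) := by
    rw [← SimpleGraph.mem_neighborSet, ho]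
    fin_cases j <;> simp
  choose σ hσ using fun j => (FlowerSnark.adj_iff hk3).1 (hmu j)
  choose τ hτ using fun j => (FlowerSnark.adj_iff hk3).1 (hov j)
  have hσinj : Function.Injective σ := fun i j h => hminj (by rw [← hσ, ← hσ, h])
  have hτinj : Function.Injective τ := fun i j h => hoinj (by rw [← hτ, ← hτ, h])
  let τ' := Equiv.ofBijective τ (Finite.injective_iff_bijective.1 hτinj)
  obtain ⟨col, hcol, hcola, hcolb, C, hC, hCcol⟩ :=
    FlowerSnark.exists_colours (t := ⟨_, hne⟩) hsum rfl
  obtain ⟨f, s, hper, hprop, hD, hCv⟩ := FlowerSnark.exists_cyclic_colouring (p := p) (q := q)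
    (by rw [hpq] at hodd; grind) (by lia)
    (FlowerSnark.admissible_of_far hk3 hp hadj hcommon)
    (FlowerSnark.admissible_of_far hk3 hq (fun h => hadj h.symm) fun w hv hu => hcommon w hu hv)
    (σ 0) (hC.comp_equiv τ'.symm)
  rw [← hpq] at hper hprop
  have hnext (w : ZMod k) : f (w + 1 - u.2).val = f ((w - u.2).val + 1) := by
    have hlt := ZMod.val_lt (w - u.2)
    rw [add_sub_right_comm, ZMod.val_add, ZMod.val_one]
    rcases Nat.lt_or_ge ((w - u.2).val + 1) k with h | h
    · rw [Nat.mod_eq_of_lt h]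
    · rw [show (w - u.2).val + 1 = k by lia, Nat.mod_self, hper]
  obtain ⟨ψ, hψ⟩ := FlowerSnark.exists_edge_colouring hk3 (fun w => f (w - u.2).val)
    (fun w => s (w - u.2).val)
  simp only [hnext] at hψ
  obtain ⟨φ, hφ, hφm, hφo⟩ := exists_pole_coloring hmu hov hminj hoinj huv hadj
    (fun e => col (ψ e)) fun x hxu hxv y z hxy hxz hyz h => by
      obtain ⟨j, rfl⟩ := (FlowerSnark.adj_iff hk3).1 hxy
      obtain ⟨l, rfl⟩ := (FlowerSnark.adj_iff hk3).1 hxz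
      have h := hcol h
      rw [hψ, hψ] at h
      refine hyz (congrArg _ ((hprop _ (ZMod.val_lt _) x.1 ?_ ?_).injective h))
      · simp only [ne_eq, Prod.mk.injEq, ZMod.val_eq_zero, sub_eq_zero]
        exact fun h => hxu (Prod.ext h.1 h.2)
      · simp only [ne_eq, Prod.mk.injEq, ← hpos, (ZMod.val_injective k).eq_iff, sub_left_inj]
        exact fun h => hxv (Prod.ext h.1 h.2)
  have hφm (j : Fin 3) : φ s(.inl (m j), .inr (j.castAdd 3)) =
      col (FlowerSnark.vertexColours (f 0) (f 1) (s 0) u.1 (σ j)) := by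
    rw [hφm, ← hσ, hψ]
    simp
  have hφo (j : Fin 3) : φ s(.inl (o j), .inr (j.natAdd 3)) = ![c, d, e] j := by
    rw [hφo, ← hτ, hψ, hpos, hCv, ← hCcol]
    exact congrArg (fun i => col (C i)) (τ'.symm_apply_apply j)
  obtain ⟨h0, h12⟩ := FlowerSnark.mem_sourceRows _ hD (σ 1) (σ 2)
    (hσinj.ne (by decide)) (hσinj.ne (by decide)) (hσinj.ne (by decide))
  refine ⟨φ, hφ, (hφm 0).trans (by rw [h0, hcola]), ?_, hφo 0, hφo 1, hφo 2⟩
  change (φ s(.inl (m 1), .inr ((1 : Fin 3).castAdd 3))).1 +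
    (φ s(.inl (m 2), .inr ((2 : Fin 3).castAdd 3))).1 = b.1
  rw [hφm, hφm]
  rcases h12 with ⟨h1, h2⟩ | ⟨h1, h2⟩ <;> rw [h1, h2]
  · exact hcolb
  · rw [add_comm, hcolb]
end

section
/- Every critical snark is cyclically 4-connected and has girth at least 5. -/
namespace CriticalSnark

/-- The Klein four-group containing the colours. -/
abbrev Klein : Type := ZMod 2 × ZMod 2

namespace Klein

theorem add_self (a : Klein) : a + a = 0 := by
  revert a; decide

theorem add_ne_zero {a b : Klein} (h : a ≠ b) : a + b ≠ 0 := by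
  revert a b; decide

theorem eq_of_add_eq_zero {a b : Klein} (h : a + b = 0) : a = b := by
  revert a b; decide

theorem eq_or_eq_or_eq_add {a b : Klein} (ha : a ≠ 0) (hb : b ≠ 0) (hab : a ≠ b)
    {x : Klein} (hx : x ≠ 0) : x = a ∨ x = b ∨ x = a + b := by
  revert a b x; decide

theorem exists_ne_zero_ne (a : Klein) : ∃ b : Klein, b ≠ 0 ∧ b ≠ a := by
  revert a; decide

theorem exists_ne_zero_ne_ne (a c : Klein) : ∃ d : Klein, d ≠ 0 ∧ d ≠ a ∧ d ≠ c := by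
  revert a c; decide

/-- Partial data at a cubic vertex with distinct nonzero entries can be completed to three
nonzero values with zero sum. -/
theorem exists_completion (a b c : Klein) (hab : a = b → a = 0) (hac : a = c → a = 0)
    (hbc : b = c → b = 0) : ∃ x y z : Klein, (x ≠ 0 ∧ y ≠ 0 ∧ z ≠ 0) ∧ x + y + z = 0 ∧
      (a ≠ 0 → x = a) ∧ (b ≠ 0 → y = b) ∧ (c ≠ 0 → z = c) := by
  have key : ∀ a b c : Klein, (a = b → a = 0) → (a = c → a = 0) → (b = c → b = 0) →
      ∃ p : Klein × Klein, (p.1 ≠ 0 ∧ p.2 ≠ 0 ∧ p.1 + p.2 ≠ 0) ∧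
        (a ≠ 0 → p.1 = a) ∧ (b ≠ 0 → p.2 = b) ∧ (c ≠ 0 → p.1 + p.2 = c) := by
    set_option synthInstance.maxHeartbeats 400000 in
    set_option synthInstance.maxSize 4096 in
    decide +kernel
  obtain ⟨p, hp, h⟩ := key a b c hab hac hbc
  exact ⟨p.1, p.2, p.1 + p.2, hp, add_self _, h⟩

/-- Two distinct nonzero elements form a basis. -/
theorem exists_hom {a b : Klein} (ha : a ≠ 0) (hb : b ≠ 0) (hab : a ≠ b) (x y : Klein) :
    ∃ σ : Klein →+ Klein, σ a = x ∧ σ b = y := by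
  have key : ∀ a b x y : Klein, a ≠ 0 → b ≠ 0 → a ≠ b → ∃ p q : Klein,
      (a.1 * p.1 + a.2 * q.1, a.1 * p.2 + a.2 * q.2) = x ∧
      (b.1 * p.1 + b.2 * q.1, b.1 * p.2 + b.2 * q.2) = y := by decide +kernel
  obtain ⟨p, q, hx, hy⟩ := key a b x y ha hb hab
  refine ⟨AddMonoidHom.mk'
    (fun v => (v.1 * p.1 + v.2 * q.1, v.1 * p.2 + v.2 * q.2)) ?_, hx, hy⟩
  intro v w
  ext <;> simp <;> ring

theorem exists_injective_hom {a b x y : Klein} (ha : a ≠ 0) (hb : b ≠ 0) (hab : a ≠ b)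
    (hx : x ≠ 0) (hy : y ≠ 0) (hxy : x ≠ y) :
    ∃ σ : Klein →+ Klein, (∀ v, v ≠ 0 → σ v ≠ 0) ∧ σ a = x ∧ σ b = y := by
  obtain ⟨σ, h1, h2⟩ := exists_hom ha hb hab x y
  refine ⟨σ, fun v hv => ?_, h1, h2⟩
  rcases eq_or_eq_or_eq_add ha hb hab hv with rfl | rfl | rfl
  · rwa [h1]
  · rwa [h2]
  · rw [map_add, h1, h2]
    exact add_ne_zero hxy

/-- Any two nowhere-zero families with zero sum on at most three indices are related by an
automorphism of the Klein group. -/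
theorem exists_hom_of_card_le_three {ι : Type*} [DecidableEq ι] (D : Finset ι) (hD : D.card ≤ 3)
    (p q : ι → Klein) (hp : ∀ i ∈ D, p i ≠ 0) (hq : ∀ i ∈ D, q i ≠ 0)
    (hps : ∑ i ∈ D, p i = 0) (hqs : ∑ i ∈ D, q i = 0) :
    ∃ σ : Klein →+ Klein, (∀ v, v ≠ 0 → σ v ≠ 0) ∧ ∀ i ∈ D, σ (p i) = q i := by
  have hcases : D.card = 0 ∨ D.card = 1 ∨ D.card = 2 ∨ D.card = 3 := by omega
  rcases hcases with h | h | h | h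
  · rw [Finset.card_eq_zero] at h
    subst h
    exact ⟨AddMonoidHom.id _, fun v hv => hv, by simp⟩
  · obtain ⟨i, rfl⟩ := Finset.card_eq_one.1 h
    simp at hps
    exact absurd hps (hp i (by simp))
  · obtain ⟨i, j, hij, rfl⟩ := Finset.card_eq_two.1 h
    rw [Finset.sum_pair hij] at hps hqs
    obtain ⟨b, hb, hbp⟩ := exists_ne_zero_ne (p i)
    obtain ⟨y, hy, hyq⟩ := exists_ne_zero_ne (q i)
    obtain ⟨σ, hσ, h1, -⟩ := exists_injective_hom (hp i (by simp)) hb hbp.symm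
      (hq i (by simp)) hy hyq.symm
    refine ⟨σ, hσ, ?_⟩
    simp [h1, ← eq_of_add_eq_zero hps, ← eq_of_add_eq_zero hqs]
  · obtain ⟨i, j, k, hij, hik, hjk, rfl⟩ := Finset.card_eq_three.1 h
    have e (f : ι → Klein) : ∑ l ∈ {i, j, k}, f l = f i + f j + f k := by
      rw [Finset.sum_insert (by simp [hij, hik]), Finset.sum_pair hjk, add_assoc]
    rw [e] at hps hqs
    have hpk := eq_of_add_eq_zero hps
    have hqk := eq_of_add_eq_zero hqs
    have hpij : p i ≠ p j := fun h => hp k (by simp) (by rw [← hpk, h, add_self])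
    have hqij : q i ≠ q j := fun h => hq k (by simp) (by rw [← hqk, h, add_self])
    obtain ⟨σ, hσ, h1, h2⟩ := exists_injective_hom (hp i (by simp)) (hp j (by simp)) hpij
      (hq i (by simp)) (hq j (by simp)) hqij
    refine ⟨σ, hσ, ?_⟩
    simp [h1, h2, ← hpk, ← hqk]

end Klein

section Flow

variable {V : Type*} {G : SimpleGraph V}

/-- Edge labels inside a vertex set are counted twice. -/
theorem sum_sum_eq_zero (f : Sym2 V → Klein) (hf : ∀ z, f s(z, z) = 0) (S : Finset V) :
    ∑ z ∈ S, ∑ w ∈ S, f s(z, w) = 0 := by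
  rw [← Finset.sum_product']
  refine Finset.sum_involution (fun x _ => x.swap) ?_ ?_ ?_ ?_
  · rintro ⟨x, y⟩ _
    simp only [Prod.fst_swap, Prod.snd_swap]
    rw [Sym2.eq_swap]
    exact Klein.add_self _
  · rintro ⟨x, y⟩ _ hne heq
    have : y = x := congrArg Prod.fst heq
    subst this
    exact hne (hf _)
  · rintro ⟨x, y⟩ h
    simpa [and_comm] using h
  · rintro ⟨x, y⟩ _
    rfl

theorem exists_neighbors (hG : IsCubic G) (z : V) : ∃ p q r : V, p ≠ q ∧ p ≠ r ∧ q ≠ r ∧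
    ∀ y, G.Adj z y ↔ y = p ∨ y = q ∨ y = r := by
  obtain ⟨p, q, r, h1, h2, h3, h⟩ := Set.ncard_eq_three.1 (hG z)
  refine ⟨p, q, r, h1, h2, h3, fun y => ?_⟩
  rw [← SimpleGraph.mem_neighborSet, h]
  simp

variable [Fintype V]

/-- The sum of an edge labelling over all edges at a vertex. -/
def boundary (f : Sym2 V → Klein) (z : V) : Klein := ∑ w, f s(z, w)

theorem boundary_add (f g : Sym2 V → Klein) (z : V) :
    boundary (f + g) z = boundary f z + boundary g z := by
  simp [boundary, Finset.sum_add_distrib]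

theorem boundary_single [DecidableEq V] {p q : V} (hpq : p ≠ q) (c : Klein) (z : V) :
    boundary (Pi.single s(p, q) c) z = (if z = p then c else 0) + (if z = q then c else 0) := by
  unfold boundary
  by_cases hp : z = p
  · subst hp
    rw [Finset.sum_eq_single q]
    · simp [hpq]
    · intro w _ hw
      rw [Pi.single_eq_of_ne]
      exact fun h => hw (Sym2.congr_right.1 h)
    · simp
  · by_cases hq : z = q
    · subst hq
      rw [Finset.sum_eq_single p]
      · simp [hp, Sym2.eq_swap]
      · intro w _ hw
        rw [Pi.single_eq_of_ne]
        simp [hp, hw]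
      · simp
    · rw [if_neg hp, if_neg hq, add_zero]
      refine Finset.sum_eq_zero fun w _ => ?_
      rw [Pi.single_eq_of_ne]
      simp [hp, hq]

theorem sum_boundary [DecidableEq V] (f : Sym2 V → Klein) (hf : ∀ z, f s(z, z) = 0)
    (S : Finset V) :
    ∑ z ∈ S, boundary f z = ∑ z ∈ S, ∑ w ∈ Sᶜ, f s(z, w) := by
  have h (z : V) : boundary f z = ∑ w ∈ S, f s(z, w) + ∑ w ∈ Sᶜ, f s(z, w) :=
    (Finset.sum_add_sum_compl S _).symm
  simp_rw [h, Finset.sum_add_distrib, sum_sum_eq_zero f hf, zero_add]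

theorem sum_eq_of_neighbors {z p q r : V} (hpq : p ≠ q) (hpr : p ≠ r) (hqr : q ≠ r)
    (h : ∀ y, G.Adj z y ↔ y = p ∨ y = q ∨ y = r) (f : V → Klein)
    (hf : ∀ y, ¬ G.Adj z y → f y = 0) : ∑ w, f w = f p + f q + f r := by
  classical
  rw [← Finset.sum_subset (Finset.subset_univ {p, q, r})]
  · rw [Finset.sum_insert (by simp [hpq, hpr]), Finset.sum_pair hqr, add_assoc]
  · intro y _ hy
    apply hf
    simpa [h] using hy

/-- A Klein flow: an edge labelling with zero boundary. -/
structure IsFlow (G : SimpleGraph V) (f : Sym2 V → Klein) : Prop where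
  supp : ∀ e, e ∉ G.edgeSet → f e = 0
  boundary : ∀ z, boundary f z = 0

theorem exists_third_neighbor (hG : IsCubic G) {f : Sym2 V → Klein} (hf : IsFlow G f)
    {z p q : V} (hp : G.Adj z p) (hq : G.Adj z q) (hpq : p ≠ q) :
    ∃ r, r ≠ p ∧ r ≠ q ∧ G.Adj z r ∧ f s(z, p) + f s(z, q) = f s(z, r) := by
  obtain ⟨a, b, c, hab, hac, hbc, h⟩ := exists_neighbors hG z
  have hs := sum_eq_of_neighbors hab hac hbc h (fun y => f s(z, y))
    (fun y hy => hf.supp _ (by simpa using hy))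
  have h0 : f s(z, a) + f s(z, b) + f s(z, c) = 0 := hs.symm.trans (hf.boundary z)
  have key : ∀ a b c : Klein, a + b + c = 0 → a + b = c ∧ a + c = b ∧ b + c = a := by decide
  obtain ⟨k1, k2, k3⟩ := key _ _ _ h0
  have ha := (h a).2 (by simp)
  have hb := (h b).2 (by simp)
  have hc := (h c).2 (by simp)
  rcases (h p).1 hp with rfl | rfl | rfl <;> rcases (h q).1 hq with rfl | rfl | rfl
  · exact absurd rfl hpq
  · exact ⟨c, hac.symm, hbc.symm, hc, k1⟩
  · exact ⟨b, hab.symm, hbc, hb, k2⟩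
  · exact ⟨c, hbc.symm, hac.symm, hc, by rw [add_comm, k1]⟩
  · exact absurd rfl hpq
  · exact ⟨a, hab, hac, ha, k3⟩
  · exact ⟨b, hbc, hab.symm, hb, by rw [add_comm, k2]⟩
  · exact ⟨a, hac, hab, ha, by rw [add_comm, k3]⟩
  · exact absurd rfl hpq

theorem threeEdgeColorable_of_flow (hG : IsCubic G) {f : Sym2 V → Klein} (hf : IsFlow G f)
    (hne : ∀ e ∈ G.edgeSet, f e ≠ 0) : ThreeEdgeColorable G := by
  classical
  refine ⟨fun e => if h : f e ≠ 0 then ⟨f e, h⟩ else ⟨(1, 0), by decide⟩, ?_⟩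
  rintro e₁ h₁ e₂ h₂ hne₁₂ ⟨v, hv₁, hv₂⟩
  obtain ⟨x, rfl⟩ := hv₁
  obtain ⟨y, rfl⟩ := hv₂
  have hxy : x ≠ y := by rintro rfl; exact hne₁₂ rfl
  obtain ⟨r, -, -, hr, hsum⟩ := exists_third_neighbor hG hf (by simpa using h₁)
    (by simpa using h₂) hxy
  simp only [dif_pos (hne _ h₁), dif_pos (hne _ h₂), ne_eq, Subtype.mk.injEq]
  intro h
  rw [h, Klein.add_self] at hsum
  exact hne s(v, r) (by simpa using hr) hsum.symm

theorem IsFlow.ne_of_adj (hG : IsCubic G) {f : Sym2 V → Klein} (hf : IsFlow G f) {e₀ : Sym2 V}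
    (hne : ∀ e ∈ G.edgeSet, e ≠ e₀ → f e ≠ 0) {z p q : V} (hp : G.Adj z p) (hq : G.Adj z q)
    (hpq : p ≠ q) (hz : z ∉ e₀) : f s(z, p) ≠ f s(z, q) := by
  obtain ⟨r, -, -, hr, hsum⟩ := exists_third_neighbor hG hf hp hq hpq
  intro h
  rw [h, Klein.add_self] at hsum
  refine hne s(z, r) (by simpa using hr) ?_ hsum.symm
  rintro rfl
  simp at hz

/-- A colouring of the subgraph induced on `S` extends to local data at every vertex of `S`. -/
theorem exists_local_completion (hG : IsCubic G) {S : Set V}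
    {f : Sym2 S → Kol}
    (hf : IsProperEdgeColoring (G.induce S) f) (x : S) :
    ∃ ψ : V → Klein, (∀ y, ψ y ≠ 0 ↔ G.Adj x y) ∧ ∑ y, ψ y = 0 ∧
      ∀ y : S, G.Adj x y → ψ y = (f s(x, y)).1 := by
  classical
  obtain ⟨p, q, r, hpq, hpr, hqr, h⟩ := exists_neighbors hG x.1
  set g : V → Klein := fun y => if hy : y ∈ S then (f s(x, ⟨y, hy⟩)).1 else 0
    with hg
  have hinj : ∀ y z : V, G.Adj x y → G.Adj x z → y ≠ z → g y = g z → g y = 0 := by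
    intro y z hy hz hyz heq
    by_contra h0
    have hyS : y ∈ S := by
      by_contra hyS
      exact h0 (dif_neg hyS)
    have hzS : z ∈ S := by
      by_contra hzS
      exact h0 (heq.trans (dif_neg hzS))
    simp only [hg, dif_pos hyS, dif_pos hzS] at heq
    refine hf s(x, ⟨y, hyS⟩) ?_ s(x, ⟨z, hzS⟩) ?_ ?_ ⟨x, by simp, by simp⟩ (Subtype.ext heq)
    · simpa using hy
    · simpa using hz
    · intro hs
      exact hyz (congrArg Subtype.val (Sym2.congr_right.1 hs))
  have hp := (h p).2 (by simp)
  have hq := (h q).2 (by simp)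
  have hr := (h r).2 (by simp)
  obtain ⟨a, b, c, ⟨ha, hb, hc⟩, hsum, ha', hb', hc'⟩ := Klein.exists_completion (g p) (g q) (g r)
    (hinj p q hp hq hpq) (hinj p r hp hr hpr) (hinj q r hq hr hqr)
  refine ⟨fun y => if y = p then a else if y = q then b else if y = r then c else 0, ?_, ?_, ?_⟩
  · intro y
    rw [h]
    dsimp only
    split_ifs <;> simp_all
  · rw [sum_eq_of_neighbors hpq hpr hqr h]
    · simpa [hpq.symm, hpr.symm, hqr.symm] using hsum
    · intro y hy
      rw [h] at hy
      push Not at hy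
      simp [hy]
  · intro y hy
    have hgy : g y = (f s(x, y)).1 := dif_pos y.2
    have hgy0 : g y ≠ 0 := hgy ▸ (f s(x, y)).2
    rw [← hgy]
    rcases (h y).1 hy with e | e | e
    · simpa [e] using ha' (e ▸ hgy0)
    · simpa [e, hpq.symm] using hb' (e ▸ hgy0)
    · simpa [e, hpr.symm, hqr.symm] using hc' (e ▸ hgy0)

/-- In a critical snark every edge is the only zero of some Klein flow. -/
theorem exists_flow_of_critical (hG : IsCubic G) (hcol : ¬ ThreeEdgeColorable G)
    (hcrit : Critical G) {u v : V} (huv : G.Adj u v) :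
    ∃ f : Sym2 V → Klein, IsFlow G f ∧ f s(u, v) = 0 ∧
      ∀ e ∈ G.edgeSet, e ≠ s(u, v) → f e ≠ 0 := by
  classical
  obtain ⟨S, hmem, c, hc⟩ : ∃ S : Set V, (∀ x, x ∉ S ↔ x = u ∨ x = v) ∧
      ThreeEdgeColorable (G.induce S) :=
    ⟨{u, v}ᶜ, fun x => by simp only [Set.mem_compl_iff, not_not]; simp, hcrit u v huv⟩
  choose ψ hψ hψsum hψc using exists_local_completion hG hc
  set g : Sym2 V → Klein := Sym2.lift ⟨fun x y => if hx : x ∈ S then ψ ⟨x, hx⟩ y else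
    if hy : y ∈ S then ψ ⟨y, hy⟩ x else 0, by
      intro x y
      by_cases hx : x ∈ S <;> by_cases hy : y ∈ S <;> simp only [hx, hy, dite_true, dite_false]
      by_cases hxy : G.Adj x y
      · rw [hψc ⟨x, hx⟩ ⟨y, hy⟩ hxy, hψc ⟨y, hy⟩ ⟨x, hx⟩ hxy.symm, Sym2.eq_swap]
      · have h1 : ψ ⟨x, hx⟩ y = 0 := by
          by_contra h0
          exact hxy ((hψ _ _).1 h0)
        have h2 : ψ ⟨y, hy⟩ x = 0 := by
          by_contra h0
          exact hxy ((hψ _ _).1 h0).symm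
        rw [h1, h2]⟩ with hg
  have hgS (x y : V) (hx : x ∈ S) : g s(x, y) = ψ ⟨x, hx⟩ y := by
    simp [hg, hx]
  have hgS' (x y : V) (hx : x ∉ S) (hy : y ∉ S) : g s(x, y) = 0 := by
    simp [hg, hx, hy]
  have hgne (x y : V) (hxy : x ∈ S ∨ y ∈ S) : g s(x, y) ≠ 0 ↔ G.Adj x y := by
    rcases hxy with h | h
    · rw [hgS x y h, hψ]
    · rw [Sym2.eq_swap, hgS y x h, hψ, SimpleGraph.adj_comm]
  have hgsupp (e) (he : e ∉ G.edgeSet) : g e = 0 := by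
    induction e with | _ x y
    by_cases hxy : x ∈ S ∨ y ∈ S
    · by_contra h0
      exact he ((hgne x y hxy).1 h0)
    · push Not at hxy
      exact hgS' x y hxy.1 hxy.2
  set f : Sym2 V → Klein := g + Pi.single s(u, v) (boundary g u) with hf
  have hfsupp (e) (he : e ∉ G.edgeSet) : f e = 0 := by
    rw [hf, Pi.add_apply, hgsupp e he, Pi.single_eq_of_ne, add_zero]
    rintro rfl
    exact he huv
  have hbS (z : V) (hz : z ≠ v) : boundary f z = 0 := by
    rw [hf, boundary_add, boundary_single huv.ne, if_neg hz, add_zero]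
    by_cases hzu : z = u
    · rw [hzu, if_pos rfl, Klein.add_self]
    · have hzS : z ∈ S := by
        by_contra h
        rcases (hmem z).1 h with h | h
        · exact hzu h
        · exact hz h
      rw [if_neg hzu, add_zero, ← hψsum ⟨z, hzS⟩]
      exact Finset.sum_congr rfl fun y _ => hgS z y hzS
  have hflow : IsFlow G f := by
    refine ⟨hfsupp, fun z => ?_⟩
    by_cases hz : z = v
    · have ht := sum_boundary f (fun z => hfsupp _ (by simp)) Finset.univ
      rw [Finset.sum_eq_single v (fun z _ hz => hbS z hz) (by simp)] at ht
      rw [hz, ht]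
      simp
    · exact hbS z hz
  have hne (e) (he : e ∈ G.edgeSet) (hev : e ≠ s(u, v)) : f e ≠ 0 := by
    rw [hf, Pi.add_apply, Pi.single_eq_of_ne hev, add_zero]
    induction e with | _ x y
    refine (hgne x y ?_).2 he
    by_contra! hxy
    have hadj : G.Adj x y := he
    rcases (hmem x).1 hxy.1 with rfl | rfl <;> rcases (hmem y).1 hxy.2 with rfl | rfl
    · exact hadj.ne rfl
    · exact hev rfl
    · exact hev Sym2.eq_swap
    · exact hadj.ne rfl
  refine ⟨f, hflow, ?_, hne⟩
  by_contra h0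
  refine hcol (threeEdgeColorable_of_flow hG hflow fun e he => ?_)
  by_cases hev : e = s(u, v)
  · rwa [hev]
  · exact hne e he hev

/-- Every edge is the only zero of some Klein flow, while no Klein flow is nowhere zero. -/
structure IsFlowCritical (G : SimpleGraph V) : Prop where
  cubic : IsCubic G
  exists_zero : ∀ f : Sym2 V → Klein, IsFlow G f → ∃ e ∈ G.edgeSet, f e = 0
  exists_flow : ∀ u v : V, G.Adj u v → ∃ f : Sym2 V → Klein, IsFlow G f ∧ f s(u, v) = 0 ∧
    ∀ e ∈ G.edgeSet, e ≠ s(u, v) → f e ≠ 0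

theorem isFlowCritical_of_critical (hG : IsSnark G) (hcrit : Critical G) : IsFlowCritical G where
  cubic := hG.2.1
  exists_zero f hf := by
    by_contra! h
    exact hG.2.2 (threeEdgeColorable_of_flow hG.2.1 hf h)
  exists_flow _ _ huv := exists_flow_of_critical hG.2.1 hG.2.2 hcrit huv

/-- A small edge cut cannot have edges on both sides. -/
theorem IsFlowCritical.no_small_cut [DecidableEq V] (hG : IsFlowCritical G) {S : Finset V}
    {D : Finset (V × V)} (hD : ∀ x y, (x, y) ∈ D ↔ x ∈ S ∧ y ∉ S ∧ G.Adj x y)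
    (hcard : D.card ≤ 3) {a a' b b' : V} (ha : G.Adj a a') (haS : a ∈ S) (haS' : a' ∈ S)
    (hb : G.Adj b b') (hbS : b ∉ S) (hbS' : b' ∉ S) : False := by
  obtain ⟨f, hf, -, hfne⟩ := hG.exists_flow a a' ha
  obtain ⟨g, hg, -, hgne⟩ := hG.exists_flow b b' hb
  have hsum (k : Sym2 V → Klein) (hk : IsFlow G k) : ∑ i ∈ D, k s(i.1, i.2) = 0 := by
    have h := sum_boundary k (fun z => hk.supp _ (by simp)) S
    simp only [hk.boundary, Finset.sum_const_zero] at h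
    rw [h, ← Finset.sum_product']
    refine Finset.sum_subset ?_ ?_
    · rintro ⟨x, y⟩ hxy
      have := (hD x y).1 hxy
      simp [this]
    · rintro ⟨x, y⟩ hxy hxyD
      rw [Finset.mem_product, Finset.mem_compl] at hxy
      apply hk.supp
      intro hadj
      exact hxyD ((hD x y).2 ⟨hxy.1, hxy.2, hadj⟩)
  obtain ⟨σ, hσ, hσD⟩ := Klein.exists_hom_of_card_le_three D hcard
    (fun i => g s(i.1, i.2)) (fun i => f s(i.1, i.2))
    (by
      rintro ⟨x, y⟩ hxy
      obtain ⟨hx, hy, hadj⟩ := (hD x y).1 hxy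
      refine hgne _ hadj fun h => ?_
      rcases Sym2.eq_iff.1 h with ⟨rfl, rfl⟩ | ⟨rfl, rfl⟩ <;> contradiction)
    (by
      rintro ⟨x, y⟩ hxy
      obtain ⟨hx, hy, hadj⟩ := (hD x y).1 hxy
      refine hfne _ hadj fun h => ?_
      rcases Sym2.eq_iff.1 h with ⟨rfl, rfl⟩ | ⟨rfl, rfl⟩ <;> contradiction)
    (hsum g hg) (hsum f hf)
  let k : Sym2 V → Klein := fun e => if ∃ x ∈ S, x ∈ e then σ (g e) else f e
  have hk : IsFlow G k := by
    refine ⟨fun e he => ?_, fun z => ?_⟩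
    · simp [k, hg.supp e he, hf.supp e he]
    · by_cases hz : z ∈ S
      · have h (w : V) : k s(z, w) = σ (g s(z, w)) := if_pos ⟨z, hz, by simp⟩
        have h' := hg.boundary z
        simp only [boundary, h] at h' ⊢
        rw [← map_sum, h', map_zero]
      · have h (w : V) : k s(z, w) = f s(z, w) := by
          by_cases hw : w ∈ S
          · have h1 : k s(z, w) = σ (g s(z, w)) := if_pos ⟨w, hw, by simp⟩
            rw [h1]
            by_cases hadj : G.Adj z w
            · have := hσD (w, z) ((hD w z).2 ⟨hw, hz, hadj.symm⟩)
              rwa [Sym2.eq_swap]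
            · rw [hg.supp _ hadj, hf.supp _ hadj, map_zero]
          · refine if_neg ?_
            rintro ⟨x, hx, hxe⟩
            rcases Sym2.mem_iff.1 hxe with rfl | rfl <;> contradiction
        have h' := hf.boundary z
        simp only [boundary, h] at h' ⊢
        exact h'
  obtain ⟨e, he, hke⟩ := hG.exists_zero k hk
  by_cases heS : ∃ x ∈ S, x ∈ e
  · simp only [k, if_pos heS] at hke
    refine hσ _ (hgne e he ?_) hke
    rintro rfl
    obtain ⟨x, hx, hxe⟩ := heS
    rcases Sym2.mem_iff.1 hxe with rfl | rfl <;> contradiction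
  · simp only [k, if_neg heS] at hke
    refine hfne e he ?_ hke
    rintro rfl
    exact heS ⟨a, haS, by simp⟩

theorem IsFlowCritical.cyclicallyConnected (hG : IsFlowCritical G) :
    CyclicallyConnected G 4 := by
  classical
  rintro ⟨F, -, hFcard, a, b, ⟨wa, hwa⟩, ⟨wb, hwb⟩, hab⟩
  let S : Finset V := Finset.univ.filter ((G.deleteEdges F).Reachable a)
  have hS (x : V) : x ∈ S ↔ (G.deleteEdges F).Reachable a x := by simp [S]
  let D : Finset (V × V) := Finset.univ.filter fun i => i.1 ∈ S ∧ i.2 ∉ S ∧ G.Adj i.1 i.2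
  have hD (x y : V) : (x, y) ∈ D ↔ x ∈ S ∧ y ∉ S ∧ G.Adj x y := by simp [D]
  have hcard : D.card ≤ 3 := by
    have h : D.card ≤ F.toFinset.card := by
      refine Finset.card_le_card_of_injOn (fun i => s(i.1, i.2)) ?_ ?_
      · rintro ⟨x, y⟩ hxy
        obtain ⟨hx, hy, hadj⟩ := (hD x y).1 hxy
        simp only [Set.coe_toFinset]
        by_contra hF
        refine hy ((hS y).2 (((hS x).1 hx).trans (SimpleGraph.Adj.reachable ?_)))
        exact SimpleGraph.deleteEdges_adj.2 ⟨hadj, hF⟩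
      · rintro ⟨x, y⟩ hxy ⟨x', y'⟩ hxy' heq
        obtain ⟨hx, hy, -⟩ := (hD x y).1 hxy
        obtain ⟨hx', hy', -⟩ := (hD x' y').1 hxy'
        rcases Sym2.eq_iff.1 heq with ⟨rfl, rfl⟩ | ⟨rfl, rfl⟩
        · rfl
        · contradiction
    rw [← Set.ncard_eq_toFinset_card'] at h
    omega
  have hadj {c : V} (w : (G.deleteEdges F).Walk c c) (hw : w.IsCycle) :
      ∃ c', (G.deleteEdges F).Adj c c' := by
    cases w with
    | nil => exact absurd hw (by simp)
    | cons h p => exact ⟨_, h⟩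
  obtain ⟨a', ha'⟩ := hadj wa hwa
  obtain ⟨b', hb'⟩ := hadj wb hwb
  refine hG.no_small_cut hD hcard (SimpleGraph.deleteEdges_adj.1 ha').1
    ((hS a).2 (SimpleGraph.Reachable.refl a)) ((hS a').2 ha'.reachable)
    (SimpleGraph.deleteEdges_adj.1 hb').1 (fun h => hab ((hS b).1 h))
    (fun h => hab (((hS b').1 h).trans hb'.reachable.symm))

set_option linter.unusedSimpArgs false in
theorem IsFlowCritical.no_triangle (hG : IsFlowCritical G) {u v t : V} (huv : G.Adj u v)
    (hvt : G.Adj v t) (htu : G.Adj t u) : False := by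
  classical
  obtain ⟨f, hf, hf0, hfne⟩ := hG.exists_flow u v huv
  have hab : f s(t, u) ≠ f s(t, v) := hf.ne_of_adj hG.cubic hfne htu hvt.symm huv.ne
    (by simp [htu.ne, hvt.ne.symm])
  have hu : f s(t, u) ≠ 0 := hfne _ htu (by simp [htu.ne, hvt.ne.symm])
  have hv : f s(t, v) ≠ 0 := hfne _ hvt.symm (by simp [htu.ne, hvt.ne.symm])
  set c := f s(t, u) + f s(t, v) with hc
  let k := f + Pi.single s(u, v) c + Pi.single s(v, t) c + Pi.single s(t, u) c
  have hk : IsFlow G k := by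
    refine ⟨fun e he => ?_, fun z => ?_⟩
    · have h1 : e ≠ s(u, v) := by rintro rfl; exact he huv
      have h2 : e ≠ s(v, t) := by rintro rfl; exact he hvt
      have h3 : e ≠ s(t, u) := by rintro rfl; exact he htu
      simp [k, hf.supp e he, h1, h2, h3]
    · have key : ∀ x y z : Klein, 0 + (x + y) + (y + z) + (z + x) = 0 := by decide +kernel
      simp only [k, boundary_add, hf.boundary, boundary_single huv.ne, boundary_single hvt.ne,
        boundary_single htu.ne]
      exact key _ _ _
  obtain ⟨e, he, hke⟩ := hG.exists_zero k hk
  have huv' := huv.ne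
  have hvt' := hvt.ne
  have htu' := htu.ne
  by_cases h1 : e = s(u, v)
  · subst h1
    simp [k, hf0, huv', hvt', htu', huv'.symm, hvt'.symm, htu'.symm] at hke
    exact Klein.add_ne_zero hab hke
  by_cases h2 : e = s(v, t)
  · subst h2
    simp [k, huv', hvt', htu', huv'.symm, hvt'.symm, htu'.symm] at hke
    rw [Sym2.eq_swap, hc, add_comm (f s(t, u)), ← add_assoc, Klein.add_self, zero_add] at hke
    exact hu hke
  by_cases h3 : e = s(t, u)
  · subst h3
    simp [k, huv', hvt', htu', huv'.symm, hvt'.symm, htu'.symm] at hke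
    rw [hc, ← add_assoc, Klein.add_self, zero_add] at hke
    exact hv hke
  · simp [k, h1, h2, h3] at hke
    exact hfne e he h1 hke

set_option linter.unusedSimpArgs false in
/-- A labelling that is nonzero off a 4-cycle and has zero boundary off it cannot be corrected
along the cycle. -/
theorem IsFlowCritical.no_correction (hG : IsFlowCritical G) {u v w x : V} (huv : G.Adj u v)
    (hvw : G.Adj v w) (hwx : G.Adj w x) (hxu : G.Adj x u) (huw : u ≠ w) (hvx : v ≠ x)
    [DecidableEq V] {f : Sym2 V → Klein} (hsupp : ∀ e, e ∉ G.edgeSet → f e = 0)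
    (hne : ∀ e ∈ G.edgeSet, e ≠ s(u, v) → e ≠ s(v, w) → e ≠ s(w, x) → e ≠ s(x, u) → f e ≠ 0)
    {α β γ δ : Klein} (hα : f s(u, v) + α ≠ 0) (hβ : f s(v, w) + β ≠ 0)
    (hγ : f s(w, x) + γ ≠ 0) (hδ : f s(x, u) + δ ≠ 0)
    (hb : ∀ z, boundary f z = if z = u then δ + α else if z = v then α + β else
      if z = w then β + γ else if z = x then γ + δ else 0) : False := by
  let k := f + Pi.single s(u, v) α + Pi.single s(v, w) β + Pi.single s(w, x) γ +
    Pi.single s(x, u) δ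
  have huv' := huv.ne
  have hvw' := hvw.ne
  have hwx' := hwx.ne
  have hxu' := hxu.ne
  have hk : IsFlow G k := by
    refine ⟨fun e he => ?_, fun z => ?_⟩
    · have h1 : e ≠ s(u, v) := by rintro rfl; exact he huv
      have h2 : e ≠ s(v, w) := by rintro rfl; exact he hvw
      have h3 : e ≠ s(w, x) := by rintro rfl; exact he hwx
      have h4 : e ≠ s(x, u) := by rintro rfl; exact he hxu
      simp [k, hsupp e he, h1, h2, h3, h4]
    · have key : ∀ a b : Klein, a + b + b + a = 0 := by decide
      have key' : ∀ a b : Klein, a + b + a + b = 0 := by decide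
      simp only [k, boundary_add, hb, boundary_single huv.ne, boundary_single hvw.ne,
        boundary_single hwx.ne, boundary_single hxu.ne]
      by_cases h1 : z = u
      · subst h1
        simp [huv', hxu'.symm, huw, key]
      by_cases h2 : z = v
      · subst h2
        simp [huv'.symm, hvw', hvx, key']
      by_cases h3 : z = w
      · subst h3
        simp [huw.symm, hvw'.symm, hwx', key']
      by_cases h4 : z = x
      · subst h4
        simp [hxu', hvx.symm, hwx'.symm, key']
      simp [h1, h2, h3, h4]
  obtain ⟨e, he, hke⟩ := hG.exists_zero k hk
  by_cases h1 : e = s(u, v)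
  · subst h1
    simp [k, huv', hvw', hwx', hxu', huw, hvx, huv'.symm, hvw'.symm, hwx'.symm,
      hxu'.symm, huw.symm, hvx.symm] at hke
    exact hα hke
  by_cases h2 : e = s(v, w)
  · subst h2
    simp [k, huv', hvw', hwx', hxu', huw, hvx, huv'.symm, hvw'.symm, hwx'.symm,
      hxu'.symm, huw.symm, hvx.symm] at hke
    exact hβ hke
  by_cases h3 : e = s(w, x)
  · subst h3
    simp [k, huv', hvw', hwx', hxu', huw, hvx, huv'.symm, hvw'.symm, hwx'.symm,
      hxu'.symm, huw.symm, hvx.symm] at hke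
    exact hγ hke
  by_cases h4 : e = s(x, u)
  · subst h4
    simp [k, huv', hvw', hwx', hxu', huw, hvx, huv'.symm, hvw'.symm, hwx'.symm,
      hxu'.symm, huw.symm, hvx.symm] at hke
    exact hδ hke
  · simp [k, h1, h2, h3, h4] at hke
    exact hne e he h1 h2 h3 h4 hke

/-- A walk yields a chain with prescribed coefficient bounded by its two ends. -/
theorem exists_chain_of_reachable [DecidableEq V] {M : SimpleGraph V} {u y : V}
    (h : M.Reachable u y) (c : Klein) :
    ∃ d : Sym2 V → Klein, (∀ e, d e = 0 ∨ d e = c) ∧ (∀ e, e ∉ M.edgeSet → d e = 0) ∧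
      ∀ z, boundary d z = (if z = u then c else 0) + (if z = y then c else 0) := by
  obtain ⟨p⟩ := h
  induction p with
  | nil => exact ⟨0, by simp, by simp, fun z => by simp [boundary, Klein.add_self]⟩
  | @cons u m y hadj p ih =>
    obtain ⟨d, hd, hsupp, hb⟩ := ih
    refine ⟨d + Pi.single s(u, m) c, fun e => ?_, fun e he => ?_, fun z => ?_⟩
    · by_cases h : e = s(u, m)
      · subst h
        rcases hd s(u, m) with h | h <;> simp [h, Klein.add_self]
      · simpa [h] using hd e
    · have h : e ≠ s(u, m) := by rintro rfl; exact he hadj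
      simp [hsupp e he, h]
    · have key : ∀ a b c : Klein, a + b + (c + a) = c + b := by decide +kernel
      rw [boundary_add, hb, boundary_single hadj.ne, key]

theorem IsFlowCritical.no_four_cycle (hG : IsFlowCritical G) {u v w x : V} (huv : G.Adj u v)
    (hvw : G.Adj v w) (hwx : G.Adj w x) (hxu : G.Adj x u) (huw : u ≠ w) (hvx : v ≠ x) :
    False := by
  classical
  have huv' := huv.ne
  have hvw' := hvw.ne
  have hwx' := hwx.ne
  have hxu' := hxu.ne
  obtain ⟨f, hf, hf0, hfne⟩ := hG.exists_flow u v huv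
  have hca : f s(v, w) ≠ f s(w, x) := by
    rw [Sym2.eq_swap]
    exact hf.ne_of_adj hG.cubic hfne hvw.symm hwx hvx (by simp [huw.symm, hvw'.symm])
  have hcb : f s(w, x) ≠ f s(x, u) := by
    rw [Sym2.eq_swap]
    exact hf.ne_of_adj hG.cubic hfne hwx.symm hxu huw.symm (by simp [hvx.symm, hxu'])
  have ha : f s(v, w) ≠ 0 := hfne _ hvw (by simp [huw.symm, huv'.symm])
  have hb : f s(x, u) ≠ 0 := hfne _ hxu (by simp [hvx.symm, hxu'])
  have hc : f s(w, x) ≠ 0 := hfne _ hwx (by simp [hvw'.symm, huw.symm])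
  generalize haf : f s(v, w) = a at *
  generalize hbf : f s(x, u) = b at *
  generalize hcf : f s(w, x) = c at *
  by_cases hab : a = b
  · subst hab
    obtain ⟨d, hd0, hda, hdc⟩ := Klein.exists_ne_zero_ne_ne a c
    refine hG.no_correction (α := d) (β := d) (γ := d) (δ := d) huv hvw hwx hxu huw hvx hf.supp
      (fun e he h _ _ _ => hfne e he h) (by simpa [hf0] using hd0) ?_ ?_ ?_ ?_
    · rw [haf]; exact Klein.add_ne_zero hda.symm
    · rw [hcf]; exact Klein.add_ne_zero hdc.symm
    · rw [hbf]; exact Klein.add_ne_zero hda.symm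
    · intro z
      simp [hf.boundary, Klein.add_self]
  obtain rfl : c = a + b := by
    rcases Klein.eq_or_eq_or_eq_add ha hb hab hc with h | h | h
    · exact absurd h.symm hca
    · exact absurd h hcb
    · exact h
  obtain ⟨l, hla, hlb⟩ := Klein.exists_hom ha hb hab (a + b) (a + b)
  have hlc : l (a + b) = 0 := by rw [map_add, hla, hlb, Klein.add_self]
  set c := a + b with hcdef
  -- the `a`-`b` Kempe chains outside the 4-cycle
  let g : Sym2 V → Klein := (fun e => l (f e)) + Pi.single s(v, w) c + Pi.single s(x, u) c
  have hgvw : g s(v, w) = 0 := by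
    simp [g, haf, hla, Klein.add_self, hvx, huv'.symm]
  have hgxu : g s(x, u) = 0 := by
    simp [g, hbf, hlb, Klein.add_self, hvx.symm, huw, hwx'.symm]
  have hguv : g s(u, v) = 0 := by
    simp [g, hf0, huv', huw, hvx, hxu'.symm]
  have hgwx : g s(w, x) = 0 := by
    simp [g, hcf, hlc, hvw'.symm, hvx.symm, hwx', huw.symm]
  have hgoff (e) (h1 : e ≠ s(v, w)) (h2 : e ≠ s(x, u)) : g e = l (f e) := by
    simp [g, h1, h2]
  have hgsupp (e) (he : e ∉ G.edgeSet) : g e = 0 := by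
    rw [hgoff, hf.supp e he, map_zero]
    · rintro rfl; exact he hvw
    · rintro rfl; exact he hxu
  have hgb (z : V) : boundary g z = (if z = v then c else 0) + (if z = w then c else 0) +
      ((if z = x then c else 0) + (if z = u then c else 0)) := by
    have h0 : boundary (fun e => l (f e)) z = 0 := by
      have := hf.boundary z
      simp only [boundary] at this ⊢
      rw [← map_sum, this, map_zero]
    rw [boundary_add, boundary_add, h0, zero_add, boundary_single hvw', boundary_single hxu']
  let M : SimpleGraph V := SimpleGraph.fromEdgeSet {e | g e ≠ 0}
  have hM (e) (he : e ∈ M.edgeSet) : g e ≠ 0 := by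
    simp only [M, SimpleGraph.edgeSet_fromEdgeSet] at he
    exact he.1
  obtain ⟨y, hy, hreach⟩ : ∃ y, (y = v ∨ y = w ∨ y = x) ∧ M.Reachable u y := by
    by_contra! hno
    have hcut := sum_boundary g (fun z => hgsupp _ (by simp))
      (Finset.univ.filter (M.Reachable u))
    rw [Finset.sum_eq_single_of_mem u (by simp), hgb] at hcut
    · rw [Finset.sum_eq_zero] at hcut
      · simp [huv', huw, hxu'.symm] at hcut
        exact hc hcut
      · intro p hp
        refine Finset.sum_eq_zero fun q hq => ?_
        simp only [Finset.mem_filter, Finset.mem_univ, true_and, Finset.mem_compl] at hp hq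
        by_contra h
        refine hq (hp.trans (SimpleGraph.Adj.reachable ?_))
        refine (SimpleGraph.fromEdgeSet_adj _).2 ⟨h, ?_⟩
        rintro rfl
        exact hq hp
    · intro z hz hzu
      simp only [Finset.mem_filter, Finset.mem_univ, true_and] at hz
      have h1 : z ≠ v := by rintro rfl; exact hno z (by simp) hz
      have h2 : z ≠ w := by rintro rfl; exact hno z (by simp) hz
      have h3 : z ≠ x := by rintro rfl; exact hno z (by simp) hz
      rw [hgb]
      simp [h1, h2, h3, hzu]
  obtain ⟨d, hdc, hdsupp, hdb⟩ := exists_chain_of_reachable hreach c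
  have hd0 (e) (he : g e = 0) : d e = 0 := hdsupp e fun h => hM e h he
  have hksupp (e) (he : e ∉ G.edgeSet) : (f + d) e = 0 := by
    simp [hf.supp e he, hd0 e (hgsupp e he)]
  have hkne (e) (he : e ∈ G.edgeSet) (h1 : e ≠ s(u, v)) (h2 : e ≠ s(v, w)) (_ : e ≠ s(w, x))
      (h4 : e ≠ s(x, u)) : (f + d) e ≠ 0 := by
    rcases hdc e with h | h
    · simpa [h] using hfne e he h1
    · rw [Pi.add_apply, h]
      refine Klein.add_ne_zero fun hfe => ?_
      have := hd0 e (by rw [hgoff e h2 h4, hfe, hlc])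
      exact hc (h.symm.trans this)
  have hkb (z : V) : boundary (f + d) z =
      (if z = u then c else 0) + (if z = y then c else 0) := by
    rw [boundary_add, hf.boundary, zero_add, hdb]
  have k1 : a + c = b := by rw [hcdef, ← add_assoc, Klein.add_self, zero_add]
  have k2 : b + c = a := by rw [hcdef, add_comm a, ← add_assoc, Klein.add_self, zero_add]
  have v1 : (f + d) s(u, v) = 0 := by simp [hf0, hd0 _ hguv]
  have v2 : (f + d) s(v, w) = a := by simp [haf, hd0 _ hgvw]
  have v3 : (f + d) s(w, x) = c := by simp [hcf, hd0 _ hgwx]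
  have v4 : (f + d) s(x, u) = b := by simp [hbf, hd0 _ hgxu]
  rcases hy with rfl | rfl | rfl
  · refine hG.no_correction (α := c) (β := 0) (γ := 0) (δ := 0) huv hvw hwx hxu huw hvx hksupp hkne
      (by simpa [v1] using hc) (by simpa [v2] using ha) (by simpa [v3] using hc)
      (by simpa [v4] using hb) fun z => ?_
    rw [hkb]
    by_cases h1 : z = u
    · subst h1; simp [huv']
    · simp [h1]
  · refine hG.no_correction (α := c) (β := c) (γ := 0) (δ := 0) huv hvw hwx hxu huw hvx hksupp hkne
      (by simpa [v1] using hc) (by simpa [v2, k1] using hb) (by simpa [v3] using hc)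
      (by simpa [v4] using hb) fun z => ?_
    rw [hkb]
    by_cases h1 : z = u
    · subst h1; simp [huw]
    · by_cases h2 : z = v
      · subst h2; simp [huv'.symm, hvw', Klein.add_self]
      · simp [h1, h2]
  · refine hG.no_correction (α := b) (β := b) (γ := b) (δ := a) huv hvw hwx hxu huw hvx hksupp hkne
      (by simpa [v1] using hb) (by rw [v2]; exact hc) (by rw [v3, add_comm, k2]; exact ha)
      (by rw [v4, add_comm]; exact hc) fun z => ?_
    rw [hkb]
    by_cases h1 : z = u
    · subst h1; simp [hxu'.symm, hcdef]
    · by_cases h2 : z = v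
      · subst h2; simp [huv'.symm, hvx, Klein.add_self]
      · by_cases h3 : z = w
        · subst h3; simp [huw.symm, hvw'.symm, hwx', Klein.add_self]
        · simp [h1, h2, h3, hcdef, add_comm]

theorem IsFlowCritical.five_le_egirth (hG : IsFlowCritical G) : 5 ≤ G.egirth := by
  rw [SimpleGraph.le_egirth]
  intro a p hp
  have h3 := hp.three_le_length
  have hnd := hp.support_nodup
  by_contra hlt
  have hlt : p.length < 5 := by
    by_contra h
    exact hlt (by exact_mod_cast not_lt.1 h)
  match p with
  | .nil => simp at h3
  | .cons _ .nil => simp at h3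
  | .cons _ (.cons _ .nil) => simp at h3
  | .cons h1 (.cons h2 (.cons h3 .nil)) => exact hG.no_triangle h1 h2 h3
  | .cons h1 (.cons h2 (.cons h3 (.cons h4 .nil))) =>
    simp at hnd
    exact hG.no_four_cycle h1 h2 h3 h4 (by tauto) (by tauto)
  | .cons _ (.cons _ (.cons _ (.cons _ (.cons _ _)))) =>
    simp at hlt
    omega

end Flow

end CriticalSnark

/-- Every critical snark is cyclically 4-connected and has girth at
least 5. -/
theorem critical_snark_cyclically4Connected_girth_ge_five
    {V : Type*} [Fintype V] (G : SimpleGraph V)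
    (hG : IsSnark G) (hcrit : Critical G) :
    CyclicallyConnected G 4 ∧ 5 ≤ G.egirth :=
  have h := CriticalSnark.isFlowCritical_of_critical hG hcrit
  ⟨h.cyclicallyConnected, h.five_le_egirth⟩
end
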